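/- Market coefficients as in the context. Let f̂, ĝ, ĥ : [0,T] → ℝ be differentiable solutions with f̂(T) = ĝ(T) = ĥ(T) = 0 of the system: f̂′ + [ (1−δ)uᵀΘ̂⁻¹u + σ_Y² ]f̂² + 2[ (1−δ)uᵀΘ̂⁻¹a + λ ]f̂ + (1−δ)aᵀΘ̂⁻¹a = 0; ĝ′ + [ (1−δ)uᵀΘ̂⁻¹a + λ ]ĝ + [ (1−δ)uᵀΘ̂⁻¹(b−rₙ) + β ]f̂ + [ (1−δ)uᵀΘ̂⁻¹u + σ_Y² ]f̂ĝ + (1−δ)aᵀΘ̂⁻¹(b−rₙ) = 0; ĥ′ + (1−δ)r + [ (1−δ)uᵀΘ̂⁻¹(b−rₙ) + β ]ĝ + (σ_Y²/2)f̂ + (1/2)[ (1−δ)uᵀΘ̂⁻¹u + σ_Y² ]ĝ² + ((1−δ)/2)(b−rₙ)ᵀΘ̂⁻¹(b−rₙ) = 0. Define φ(t,y) = exp( (f̂(t)/2)·y² + ĝ(t)·y + ĥ(t) ). Then φ > 0, φ(T,y) = 1 for all y ∈ ℝ, and for every (t,y) ∈ [0,T] × ℝ: ∂_tφ + (1−δ)·r·φ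 + ((1−δ)/2)·φ·(a·y + b − rₙ)ᵀΘ̂⁻¹(a·y + b − rₙ) + (1−δ)·∂_yφ·uᵀΘ̂⁻¹(a·y + b − rₙ) + ((1−δ)/2)·((∂_yφ)²/φ)·uᵀΘ̂⁻¹u + (λy + β)·∂_yφ + (σ_Y²/2)·∂²_{yy}φ = 0. (The analytic core of Theorem 2 of the paper: the exponential-quadratic ansatz solves the reduced full-information HJB PDE.) -/

import Mathlib

open Matrix

lemma Matrix.IsSymm.dotProduct_mulVec_comm {n : Type*} [Fintype n] {M : Matrix n n ℝ}
    (hM : M.IsSymm) (v w : n → ℝ) : v ⬝ᵥ (M *ᵥ w) = w ⬝ᵥ (M *ᵥ v) := by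
  rw [dotProduct_mulVec, ← mulVec_transpose, hM.eq, dotProduct_comm]

lemma Matrix.IsSymm.quadraticForm_smul_add {n : Type*} [Fintype n] {M : Matrix n n ℝ}
    (hM : M.IsSymm) (y : ℝ) (v w : n → ℝ) :
    (y • v + w) ⬝ᵥ (M *ᵥ (y • v + w)) =
      y ^ 2 * (v ⬝ᵥ (M *ᵥ v)) + 2 * y * (v ⬝ᵥ (M *ᵥ w)) + w ⬝ᵥ (M *ᵥ w) := by
  simp only [mulVec_add, mulVec_smul, dotProduct_add, add_dotProduct, dotProduct_smul,
    smul_dotProduct, smul_eq_mul, hM.dotProduct_mulVec_comm w v]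
  ring

lemma hasDerivAt_exp_quadratic (p q s y : ℝ) :
    HasDerivAt (fun z => Real.exp (p / 2 * z ^ 2 + q * z + s))
      ((p * y + q) * Real.exp (p / 2 * y ^ 2 + q * y + s)) y := by
  have h := ((((hasDerivAt_id y).pow 2).const_mul (p / 2)).add
    ((hasDerivAt_id y).const_mul q)).add_const s |>.exp
  refine h.congr_deriv ?_
  simp
  ring

lemma deriv_exp_quadratic (p q s : ℝ) :
    deriv (fun z => Real.exp (p / 2 * z ^ 2 + q * z + s)) =
      fun z => (p * z + q) * Real.exp (p / 2 * z ^ 2 + q * z + s) :=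
  funext fun y => (hasDerivAt_exp_quadratic p q s y).deriv

lemma deriv_deriv_exp_quadratic (p q s y : ℝ) :
    deriv (deriv (fun z => Real.exp (p / 2 * z ^ 2 + q * z + s))) y =
      (p + (p * y + q) ^ 2) * Real.exp (p / 2 * y ^ 2 + q * y + s) := by
  rw [deriv_exp_quadratic]
  have h := (((hasDerivAt_id y).const_mul p).add_const q).mul (hasDerivAt_exp_quadratic p q s y)
  refine (h.congr_deriv ?_).deriv
  simp
  ring

/-- Analytic core of Theorem 2 of the paper: the exponential-quadratic ansatz
`φ(t,y) = exp((f̂(t)/2)y² + ĝ(t)y + ĥ(t))`, with `(f̂, ĝ, ĥ)` solving the full-information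
ODE system with zero terminal conditions, is positive, satisfies `φ(T,·) = 1` and solves the
reduced full-information HJB PDE. -/
theorem stmt_8 (n : ℕ) (a b u : Fin n → ℝ) (r σY lam β δ : ℝ)
    (hδ : 0 < δ) (hδ1 : δ ≠ 1) (hσY : 0 < σY)
    (Θ : Matrix (Fin n) (Fin n) ℝ) (hΘ : Θ.PosDef)
    (T : ℝ) (fhat ghat hhat : ℝ → ℝ)
    (hfT : fhat T = 0) (hgT : ghat T = 0) (hhT : hhat T = 0)
    (hf : ∀ t ∈ Set.Icc (0:ℝ) T,
      HasDerivAt fhat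
        (-(((1 - δ) * (u ⬝ᵥ (Θ⁻¹ *ᵥ u)) + σY ^ 2) * fhat t ^ 2 +
            2 * ((1 - δ) * (u ⬝ᵥ (Θ⁻¹ *ᵥ a)) + lam) * fhat t +
            (1 - δ) * (a ⬝ᵥ (Θ⁻¹ *ᵥ a)))) t)
    (hg : ∀ t ∈ Set.Icc (0:ℝ) T,
      HasDerivAt ghat
        (-(((1 - δ) * (u ⬝ᵥ (Θ⁻¹ *ᵥ a)) + lam) * ghat t +
            ((1 - δ) * (u ⬝ᵥ (Θ⁻¹ *ᵥ (b - r • (1 : Fin n → ℝ)))) + β) * fhat t +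
            ((1 - δ) * (u ⬝ᵥ (Θ⁻¹ *ᵥ u)) + σY ^ 2) * fhat t * ghat t +
            (1 - δ) * (a ⬝ᵥ (Θ⁻¹ *ᵥ (b - r • (1 : Fin n → ℝ)))))) t)
    (hh : ∀ t ∈ Set.Icc (0:ℝ) T,
      HasDerivAt hhat
        (-((1 - δ) * r +
            ((1 - δ) * (u ⬝ᵥ (Θ⁻¹ *ᵥ (b - r • (1 : Fin n → ℝ)))) + β) * ghat t +
            (σY ^ 2 / 2) * fhat t +
            (1 / 2) * ((1 - δ) * (u ⬝ᵥ (Θ⁻¹ *ᵥ u)) + σY ^ 2) * ghat t ^ 2 +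
            ((1 - δ) / 2) *
              ((b - r • (1 : Fin n → ℝ)) ⬝ᵥ (Θ⁻¹ *ᵥ (b - r • (1 : Fin n → ℝ)))))) t) :
    let φ : ℝ → ℝ → ℝ := fun t y => Real.exp (fhat t / 2 * y ^ 2 + ghat t * y + hhat t)
    ∀ t ∈ Set.Icc (0:ℝ) T, ∀ y : ℝ,
      0 < φ t y ∧ φ T y = 1 ∧
      deriv (fun s => φ s y) t + (1 - δ) * r * φ t y +
        ((1 - δ) / 2) * φ t y *
          ((y • a + b - r • (1 : Fin n → ℝ)) ⬝ᵥ
            (Θ⁻¹ *ᵥ (y • a + b - r • (1 : Fin n → ℝ)))) +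
        (1 - δ) * deriv (fun z => φ t z) y *
          (u ⬝ᵥ (Θ⁻¹ *ᵥ (y • a + b - r • (1 : Fin n → ℝ)))) +
        ((1 - δ) / 2) * ((deriv (fun z => φ t z) y) ^ 2 / φ t y) *
          (u ⬝ᵥ (Θ⁻¹ *ᵥ u)) +
        (lam * y + β) * deriv (fun z => φ t z) y +
        (σY ^ 2 / 2) * deriv (deriv (fun z => φ t z)) y = 0 := by
  intro φ t ht y
  refine ⟨Real.exp_pos _, by simp [φ, hfT, hgT, hhT], ?_⟩
  have hM : (Θ⁻¹).IsSymm := by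
    simpa [IsHermitian, IsSymm] using hΘ.isHermitian.inv
  have hpos : 0 < φ t y := Real.exp_pos _
  have htime := (((((hf t ht).div_const 2).mul_const (y ^ 2)).add
    ((hg t ht).mul_const y)).add (hh t ht)).exp.deriv
  change deriv (fun s => φ s y) t = φ t y * _ at htime
  have hspace : deriv (fun z => φ t z) y = (fhat t * y + ghat t) * φ t y :=
    congrFun (deriv_exp_quadratic _ _ _) y
  have hspace₂ : deriv (deriv (fun z => φ t z)) y =
      (fhat t + (fhat t * y + ghat t) ^ 2) * φ t y :=
    deriv_deriv_exp_quadratic _ _ _ y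
  have hratio : ((fhat t * y + ghat t) * φ t y) ^ 2 / φ t y =
      (fhat t * y + ghat t) ^ 2 * φ t y := by
    field_simp
  rw [htime, hspace₂, hspace, hratio, add_sub_assoc, hM.quadraticForm_smul_add]
  simp only [mulVec_add (Θ⁻¹) (y • a), mulVec_smul (Θ⁻¹) y, dotProduct_add u, dotProduct_smul y u,
    smul_eq_mul]
  ring
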